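/- Suppose each μⱼ and ν are doubling and E ⊆ S_μ ∩ S_ν is a Borel set with H^{q,t}_{μ,ν}(E) < ∞. Then D̄^{q,t}_{μ,ν}(x,E) = 1 for H^{q,t}_{μ,ν}-almost every x ∈ E. -/

import Mathlib

open MeasureTheory Metric Set Filter ENNReal Topology

noncomputable section

namespace MixedMultifractal

variable {X : Type*} [MetricSpace X] [MeasurableSpace X]

/-- `ℝ^d` as a Euclidean space. -/
abbrev Rd (d : ℕ) := EuclideanSpace ℝ (Fin d)

/-- A centered `δ`-covering of `E`: a countable family of closed balls with centers in `E`
and radii in `(0, δ)` covering `E`. -/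
def IsCenteredCover (E : Set X) (δ : ℝ) (I : Set (X × ℝ)) : Prop :=
  I.Countable ∧ (∀ p ∈ I, p.1 ∈ E ∧ 0 < p.2 ∧ p.2 < δ) ∧
    E ⊆ ⋃ p ∈ I, closedBall p.1 p.2

/-- A centered `δ`-packing of `E`: a countable family of pairwise disjoint closed balls
with centers in `E` and radii in `(0, δ)`. -/
def IsCenteredPacking (E : Set X) (δ : ℝ) (I : Set (X × ℝ)) : Prop :=
  I.Countable ∧ (∀ p ∈ I, p.1 ∈ E ∧ 0 < p.2 ∧ p.2 < δ) ∧
    I.Pairwise fun p p' => Disjoint (closedBall p.1 p.2) (closedBall p'.1 p'.2)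

/-- Pre-measure `H̄_δ` associated with a gauge `g` on balls (a ball is coded by its
center-radius pair). -/
def preH (g : X × ℝ → ℝ≥0∞) (δ : ℝ) (E : Set X) : ℝ≥0∞ :=
  ⨅ (I : Set (X × ℝ)) (_ : IsCenteredCover E δ I), ∑' p : I, g (p : X × ℝ)

/-- `H̄ = sup_{δ > 0} H̄_δ` (the limit as `δ ↓ 0`). -/
def barH (g : X × ℝ → ℝ≥0∞) (E : Set X) : ℝ≥0∞ :=
  ⨆ (δ : ℝ) (_ : 0 < δ), preH g δ E

/-- The (generalized) multifractal Hausdorff measure: `H(E) = sup_{F ⊆ E} H̄(F)`. -/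
def mixedH (g : X × ℝ → ℝ≥0∞) (E : Set X) : ℝ≥0∞ :=
  ⨆ (F : Set X) (_ : F ⊆ E), barH g F

/-- Pre-measure `P̄_δ` associated with a gauge `g` on balls. -/
def preP (g : X × ℝ → ℝ≥0∞) (δ : ℝ) (E : Set X) : ℝ≥0∞ :=
  ⨆ (I : Set (X × ℝ)) (_ : IsCenteredPacking E δ I), ∑' p : I, g (p : X × ℝ)

/-- `P̄ = inf_{δ > 0} P̄_δ` (the limit as `δ ↓ 0`). -/
def barP (g : X × ℝ → ℝ≥0∞) (E : Set X) : ℝ≥0∞ :=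
  ⨅ (δ : ℝ) (_ : 0 < δ), preP g δ E

/-- The (generalized) multifractal packing measure:
`P(E) = inf { Σ P̄(Eₙ) : E ⊆ ⋃ Eₙ }`. -/
def mixedP (g : X × ℝ → ℝ≥0∞) (E : Set X) : ℝ≥0∞ :=
  ⨅ (s : ℕ → Set X) (_ : E ⊆ ⋃ n, s n), ∑' n, barP g (s n)

/-- The mixed multifractal gauge `μ(B(x,r))^q · ν(B(x,r))^t` with
`μ(B)^q = ∏ⱼ μⱼ(B)^{qⱼ}` (here `^` is `ENNReal.rpow`, so `0 ^ s = ∞` for `s < 0` and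
`0 ^ 0 = 1`). -/
def mgauge {k : ℕ} (μ : Fin k → Measure X) (q : Fin k → ℝ) (ν : Measure X) (t : ℝ) :
    X × ℝ → ℝ≥0∞ :=
  fun p => (∏ j, μ j (closedBall p.1 p.2) ^ q j) * ν (closedBall p.1 p.2) ^ t

/-- The non-mixed multifractal gauge `μ(B(x,r))^q · (2r)^s`. -/
def sgauge {k : ℕ} (μ : Fin k → Measure X) (q : Fin k → ℝ) (s : ℝ) :
    X × ℝ → ℝ≥0∞ :=
  fun p => (∏ j, μ j (closedBall p.1 p.2) ^ q j) * ENNReal.ofReal (2 * p.2) ^ s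

/-- The topological support of a measure. -/
def msupport (σ : Measure X) : Set X :=
  {x : X | ∀ r : ℝ, 0 < r → 0 < σ (closedBall x r)}

/-- `S_μ = supp μ₁ ∩ … ∩ supp μ_k`. -/
def Smu {k : ℕ} (μ : Fin k → Measure X) : Set X := ⋂ j, msupport (μ j)

/-- A measure `σ` is doubling if for some `a > 1`,
`limsup_{r ↓ 0} sup_{x ∈ supp σ} σ(B(x,ar))/σ(B(x,r)) < ∞`. -/
def IsDoubling (σ : Measure X) : Prop :=
  ∃ a : ℝ, 1 < a ∧
    limsup (fun r : ℝ => ⨆ x ∈ msupport σ, σ (closedBall x (a * r)) / σ (closedBall x r))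
      (𝓝[>] (0 : ℝ)) < ⊤

/-- `ν` is quasi-Ahlfors regular with index `α`: `limsup_{|U| → 0} ν(U)/|U|^α < ∞`,
i.e. there are `M < ∞` and `δ > 0` with `ν(U) ≤ M · |U|^α` whenever `|U| < δ`. -/
def IsQuasiAhlfors (ν : Measure X) (α : ℝ) : Prop :=
  ∃ M : ℝ≥0∞, M ≠ ⊤ ∧ ∃ δ : ℝ, 0 < δ ∧
    ∀ U : Set X, EMetric.diam U < ENNReal.ofReal δ → ν U ≤ M * EMetric.diam U ^ α

/-- The upper `(q,t)`-density of `θ` at `x` relative to `(μ, ν)`. -/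
def upperDensity {k : ℕ} (μ : Fin k → Measure X) (q : Fin k → ℝ) (ν : Measure X) (t : ℝ)
    (θ : Measure X) (x : X) : ℝ≥0∞ :=
  limsup (fun r : ℝ => θ (closedBall x r) / mgauge μ q ν t (x, r)) (𝓝[>] (0 : ℝ))

/-- The lower `(q,t)`-density of `θ` at `x` relative to `(μ, ν)`. -/
def lowerDensity {k : ℕ} (μ : Fin k → Measure X) (q : Fin k → ℝ) (ν : Measure X) (t : ℝ)
    (θ : Measure X) (x : X) : ℝ≥0∞ :=
  liminf (fun r : ℝ => θ (closedBall x r) / mgauge μ q ν t (x, r)) (𝓝[>] (0 : ℝ))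

/-- The upper density at `x` of a set function `m` evaluated on `E ∩ B(x,r)`, relative to
the mixed gauge; used for `D̄` (with `m = H^{q,t}`) and `Δ̄` (with `m = P^{q,t}`). -/
def upperSetDensity {k : ℕ} (m : Set X → ℝ≥0∞) (μ : Fin k → Measure X) (q : Fin k → ℝ)
    (ν : Measure X) (t : ℝ) (E : Set X) (x : X) : ℝ≥0∞ :=
  limsup (fun r : ℝ => m (E ∩ closedBall x r) / mgauge μ q ν t (x, r)) (𝓝[>] (0 : ℝ))

/-- The lower density at `x` of a set function `m` evaluated on `E ∩ B(x,r)`; used for `D̲`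
and `Δ̲`. -/
def lowerSetDensity {k : ℕ} (m : Set X → ℝ≥0∞) (μ : Fin k → Measure X) (q : Fin k → ℝ)
    (ν : Measure X) (t : ℝ) (E : Set X) (x : X) : ℝ≥0∞ :=
  liminf (fun r : ℝ => m (E ∩ closedBall x r) / mgauge μ q ν t (x, r)) (𝓝[>] (0 : ℝ))

/-- The mixed multifractal Hausdorff dimension `dim^q_{μ,ν}`. -/
def mixedHDim {k : ℕ} (μ : Fin k → Measure X) (q : Fin k → ℝ) (ν : Measure X)
    (A : Set X) : ℝ :=
  sInf {s : ℝ | mixedH (mgauge μ q ν s) A = 0}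

/-- The mixed multifractal packing dimension `Dim^q_{μ,ν}`. -/
def mixedPDim {k : ℕ} (μ : Fin k → Measure X) (q : Fin k → ℝ) (ν : Measure X)
    (A : Set X) : ℝ :=
  sInf {s : ℝ | mixedP (mgauge μ q ν s) A = 0}

/-- Carathéodory measurability of `F` with respect to a set function `m`. -/
def CaratheodoryMeasurable (m : Set X → ℝ≥0∞) (F : Set X) : Prop :=
  ∀ A : Set X, m A = m (A ∩ F) + m (A \ F)

/-- `D̄^{q,t}_{μ,ν}(x, A)`: upper density of the mixed Hausdorff measure of `A` near `x`. -/
def DUpper {k : ℕ} (μ : Fin k → Measure X) (q : Fin k → ℝ) (ν : Measure X) (t : ℝ)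
    (A : Set X) (x : X) : ℝ≥0∞ :=
  upperSetDensity (mixedH (mgauge μ q ν t)) μ q ν t A x

/-- `D̲^{q,t}_{μ,ν}(x, A)`: lower density of the mixed Hausdorff measure of `A` near `x`. -/
def DLower {k : ℕ} (μ : Fin k → Measure X) (q : Fin k → ℝ) (ν : Measure X) (t : ℝ)
    (A : Set X) (x : X) : ℝ≥0∞ :=
  lowerSetDensity (mixedH (mgauge μ q ν t)) μ q ν t A x

/-- `Δ̄^{q,t}_{μ,ν}(x, A)`: upper density of the mixed packing measure of `A` near `x`. -/
def DeltaUpper {k : ℕ} (μ : Fin k → Measure X) (q : Fin k → ℝ) (ν : Measure X) (t : ℝ)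
    (A : Set X) (x : X) : ℝ≥0∞ :=
  upperSetDensity (mixedP (mgauge μ q ν t)) μ q ν t A x

/-- `Δ̲^{q,t}_{μ,ν}(x, A)`: lower density of the mixed packing measure of `A` near `x`. -/
def DeltaLower {k : ℕ} (μ : Fin k → Measure X) (q : Fin k → ℝ) (ν : Measure X) (t : ℝ)
    (A : Set X) (x : X) : ℝ≥0∞ :=
  lowerSetDensity (mixedP (mgauge μ q ν t)) μ q ν t A x

section CenteredHausdorff

variable {Y : Type*} [MetricSpace Y] {g : Y × ℝ → ℝ≥0∞} {E F G : Set Y} {δ : ℝ} {c : ℝ≥0∞}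

theorem IsCenteredCover.iUnion {ι : Type*} [Countable ι] {s : ι → Set Y} {I : ι → Set (Y × ℝ)}
    (h : ∀ i, IsCenteredCover (s i) δ (I i)) : IsCenteredCover (⋃ i, s i) δ (⋃ i, I i) := by
  refine ⟨countable_iUnion fun i => (h i).1, fun p hp => ?_, iUnion_subset fun i x hx => ?_⟩
  · obtain ⟨i, hi⟩ := mem_iUnion.1 hp
    exact ⟨mem_iUnion.2 ⟨i, ((h i).2.1 p hi).1⟩, ((h i).2.1 p hi).2⟩
  · obtain ⟨p, hp, hxp⟩ := mem_iUnion₂.1 ((h i).2.2 hx)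
    exact mem_iUnion₂.2 ⟨p, mem_iUnion.2 ⟨i, hp⟩, hxp⟩

theorem preH_le_tsum {I : Set (Y × ℝ)} (h : IsCenteredCover E δ I) :
    preH g δ E ≤ ∑' p : I, g (p : Y × ℝ) :=
  iInf₂_le I h

theorem preH_iUnion_le {ι : Type*} [Countable ι] (g : Y × ℝ → ℝ≥0∞) (δ : ℝ) (s : ι → Set Y) :
    preH g δ (⋃ i, s i) ≤ ∑' i, preH g δ (s i) := by
  refine ENNReal.le_of_forall_pos_le_add fun ε hε hlt => ?_
  obtain ⟨ε', hε', hsum⟩ :=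
    ENNReal.exists_pos_sum_of_countable' (ENNReal.coe_pos.2 hε).ne' ι
  have key : ∀ i, ∃ I, IsCenteredCover (s i) δ I ∧
      ∑' p : I, g (p : Y × ℝ) < preH g δ (s i) + ε' i := fun i => by
    have h : preH g δ (s i) < preH g δ (s i) + ε' i :=
      ENNReal.lt_add_right (ENNReal.ne_top_of_tsum_ne_top hlt.ne i) (hε' i).ne'
    obtain ⟨I, hI⟩ := iInf_lt_iff.1 h
    obtain ⟨hc, hI⟩ := iInf_lt_iff.1 hI
    exact ⟨I, hc, hI⟩
  choose I hI hlt' using key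
  calc preH g δ (⋃ i, s i) ≤ ∑' p : ⋃ i, I i, g (p : Y × ℝ) :=
        preH_le_tsum (IsCenteredCover.iUnion hI)
    _ ≤ ∑' i, ∑' p : I i, g (p : Y × ℝ) := ENNReal.tsum_iUnion_le_tsum g I
    _ ≤ ∑' i, (preH g δ (s i) + ε' i) := ENNReal.tsum_le_tsum fun i => (hlt' i).le
    _ = ∑' i, preH g δ (s i) + ∑' i, ε' i := ENNReal.tsum_add
    _ ≤ ∑' i, preH g δ (s i) + ε := by gcongr

theorem preH_union_le (g : Y × ℝ → ℝ≥0∞) (δ : ℝ) (A B : Set Y) :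
    preH g δ (A ∪ B) ≤ preH g δ A + preH g δ B := by
  rw [union_eq_iUnion]
  refine (preH_iUnion_le g δ _).trans_eq ?_
  rw [tsum_bool, add_comm]
  rfl

theorem preH_anti (g : Y × ℝ → ℝ≥0∞) (E : Set Y) : Antitone fun δ => preH g δ E :=
  fun _ _ h => le_iInf₂ fun _ hI =>
    preH_le_tsum ⟨hI.1, fun p hp => ⟨(hI.2.1 p hp).1, (hI.2.1 p hp).2.1,
      (hI.2.1 p hp).2.2.trans_le h⟩, hI.2.2⟩

theorem preH_le_barH (hδ : 0 < δ) : preH g δ E ≤ barH g E :=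
  le_iSup₂ (f := fun (δ : ℝ) (_ : 0 < δ) => preH g δ E) δ hδ

theorem barH_le_mixedH (h : F ⊆ E) : barH g F ≤ mixedH g E :=
  le_iSup₂ (f := fun (F : Set Y) (_ : F ⊆ E) => barH g F) F h

theorem mixedH_mono (h : F ⊆ E) : mixedH g F ≤ mixedH g E :=
  iSup₂_le fun _ hG => barH_le_mixedH (hG.trans h)

theorem barH_iUnion_le (g : Y × ℝ → ℝ≥0∞) (s : ℕ → Set Y) :
    barH g (⋃ n, s n) ≤ ∑' n, barH g (s n) :=
  iSup₂_le fun δ hδ => (preH_iUnion_le g δ s).trans <|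
    ENNReal.tsum_le_tsum fun _ => preH_le_barH hδ

theorem mixedH_iUnion_le (g : Y × ℝ → ℝ≥0∞) (s : ℕ → Set Y) :
    mixedH g (⋃ n, s n) ≤ ∑' n, mixedH g (s n) := by
  refine iSup₂_le fun F hF => ?_
  rw [← inter_eq_left.2 hF, inter_iUnion]
  exact (barH_iUnion_le g _).trans <|
    ENNReal.tsum_le_tsum fun _ => barH_le_mixedH inter_subset_right

theorem mixedH_empty (g : Y × ℝ → ℝ≥0∞) : mixedH g ∅ = 0 := by
  refine le_antisymm (iSup₂_le fun F hF => iSup₂_le fun δ _ => ?_) zero_le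
  refine (preH_le_tsum (I := ∅) ⟨countable_empty, by simp, by simpa using hF⟩).trans ?_
  simp

/-- The multifractal Hausdorff measure as an outer measure. -/
def mixedHOuter (g : Y × ℝ → ℝ≥0∞) : OuterMeasure Y where
  measureOf := mixedH g
  empty := mixedH_empty g
  mono := mixedH_mono
  iUnion_nat s _ := mixedH_iUnion_le g s

theorem mixedHOuter_apply (g : Y × ℝ → ℝ≥0∞) (E : Set Y) : mixedHOuter g E = mixedH g E := rfl

theorem IsCenteredCover.sep_fst_mem {A B : Set Y} {I : Set (Y × ℝ)}
    (h : IsCenteredCover (A ∪ B) δ I) (hAB : ∀ x ∈ A, ∀ y ∈ B, δ ≤ dist x y) :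
    IsCenteredCover A δ {p ∈ I | p.1 ∈ A} := by
  refine ⟨h.1.mono (sep_subset _ _), fun p hp => ⟨hp.2, (h.2.1 p hp.1).2⟩, fun x hx => ?_⟩
  obtain ⟨p, hp, hxp⟩ := mem_iUnion₂.1 (h.2.2 (mem_union_left B hx))
  refine mem_iUnion₂.2 ⟨p, ⟨hp, (h.2.1 p hp).1.resolve_right fun hB => ?_⟩, hxp⟩
  exact absurd ((hAB x hx _ hB).trans hxp) (not_le.2 (h.2.1 p hp).2.2)

theorem preH_add_le {A B : Set Y} (hAB : ∀ x ∈ A, ∀ y ∈ B, δ ≤ dist x y) (hδ : 0 < δ) :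
    preH g δ A + preH g δ B ≤ preH g δ (A ∪ B) := by
  refine le_iInf₂ fun I hI => ?_
  have hdisj : Disjoint {p ∈ I | p.1 ∈ A} {p ∈ I | p.1 ∈ B} := by
    refine Set.disjoint_left.2 fun p hpA hpB => ?_
    have := hAB _ hpA.2 _ hpB.2
    rw [dist_self] at this
    exact absurd this (not_le.2 hδ)
  calc preH g δ A + preH g δ B
      ≤ ∑' p : {p ∈ I | p.1 ∈ A}, g (p : Y × ℝ) + ∑' p : {p ∈ I | p.1 ∈ B}, g (p : Y × ℝ) :=
        add_le_add (preH_le_tsum (hI.sep_fst_mem hAB))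
          (preH_le_tsum ((union_comm A B ▸ hI).sep_fst_mem
            fun x hx y hy => dist_comm y x ▸ hAB y hy x hx))
    _ = ∑' p : ({p ∈ I | p.1 ∈ A} ∪ {p ∈ I | p.1 ∈ B} : Set (Y × ℝ)), g (p : Y × ℝ) :=
        (ENNReal.summable.tsum_union_disjoint hdisj ENNReal.summable).symm
    _ ≤ ∑' p : I, g (p : Y × ℝ) :=
        ENNReal.tsum_mono_subtype g (union_subset (sep_subset _ _) (sep_subset _ _))

theorem mixedHOuter_isMetric (g : Y × ℝ → ℝ≥0∞) : (mixedHOuter g).IsMetric := by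
  rintro A B ⟨r, hr0, hr⟩
  refine le_antisymm (measure_union_le A B) ?_
  obtain ⟨ρ, hρ0, hρ⟩ := ENNReal.lt_iff_exists_nnreal_btwn.1 (pos_iff_ne_zero.2 hr0)
  have hdist : ∀ x ∈ A, ∀ y ∈ B, (ρ : ℝ) ≤ dist x y := fun x hx y hy => by
    have := hρ.le.trans (hr x hx y hy)
    rw [edist_nndist, ENNReal.coe_le_coe] at this
    exact_mod_cast this
  refine ENNReal.biSup_add_biSup_le' ⟨∅, empty_subset A⟩ ⟨∅, empty_subset B⟩
    fun F hF G hG => ENNReal.biSup_add_biSup_le' ⟨1, one_pos⟩ ⟨1, one_pos⟩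
    fun δ hδ δ' hδ' => ?_
  have hm : 0 < min (min δ δ') (ρ : ℝ) :=
    lt_min (lt_min hδ hδ') (by exact_mod_cast ENNReal.coe_pos.1 hρ0)
  calc preH g δ F + preH g δ' G
      ≤ preH g (min (min δ δ') ρ) F + preH g (min (min δ δ') ρ) G :=
        add_le_add (preH_anti g F ((min_le_left _ _).trans (min_le_left _ _)))
          (preH_anti g G ((min_le_left _ _).trans (min_le_right _ _)))
    _ ≤ preH g (min (min δ δ') ρ) (F ∪ G) :=
        preH_add_le (fun x hx y hy => (min_le_right _ _).trans
          (hdist x (hF hx) y (hG hy))) hm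
    _ ≤ barH g (F ∪ G) := preH_le_barH hm
    _ ≤ mixedH g (A ∪ B) := barH_le_mixedH (union_subset_union hF hG)

/-- A set on which the density of `H` stays below `c < 1` uniformly at small scales is null. -/
theorem mixedH_eq_zero_of_le_mul (hfin : mixedH g F ≠ ⊤) (hFE : F ⊆ E) (hc0 : c ≠ 0) (hc : c < 1)
    (hδ : 0 < δ)
    (h : ∀ x ∈ F, ∀ r, 0 < r → r < δ → mixedH g (E ∩ closedBall x r) ≤ c * g (x, r)) :
    mixedH g F = 0 := by
  have hct : c ≠ ⊤ := (hc.trans one_lt_top).ne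
  have hle : mixedH g F / c ≤ preH g δ F := by
    refine le_iInf₂ fun I hI => ENNReal.div_le_of_le_mul ?_
    calc mixedH g F ≤ mixedHOuter g (⋃ p ∈ I, E ∩ closedBall p.1 p.2) := by
          refine mixedH_mono ?_
          rw [← inter_iUnion₂]
          exact subset_inter hFE hI.2.2
      _ ≤ ∑' p : I, mixedHOuter g (E ∩ closedBall p.1.1 p.1.2) :=
          measure_biUnion_le _ hI.1 _
      _ ≤ ∑' p : I, c * g (p : Y × ℝ) := ENNReal.tsum_le_tsum fun p =>
          h _ (hI.2.1 p p.2).1 _ (hI.2.1 p p.2).2.1 (hI.2.1 p p.2).2.2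
      _ = (∑' p : I, g (p : Y × ℝ)) * c := by rw [ENNReal.tsum_mul_left, mul_comm]
  have hle' : mixedH g F / c ≤ mixedH g F :=
    hle.trans ((preH_le_barH hδ).trans (barH_le_mixedH Subset.rfl))
  rw [ENNReal.div_le_iff hc0 hct] at hle'
  by_contra h0
  exact absurd hle' (not_le.2 (by simpa using ENNReal.mul_lt_mul_right h0 hfin hc))

theorem mixedH_sep_limsup_lt_one (hfin : mixedH g E ≠ ⊤) (hg0 : ∀ x ∈ E, ∀ r, 0 < r → g (x, r) ≠ 0)
    (hgt : ∀ x ∈ E, ∀ r, 0 < r → g (x, r) ≠ ⊤) :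
    mixedH g {x ∈ E |
      limsup (fun r : ℝ => mixedH g (E ∩ closedBall x r) / g (x, r)) (𝓝[>] (0 : ℝ)) < 1} = 0 := by
  obtain ⟨u, -, hu, hulim⟩ := exists_seq_strictMono_tendsto' (zero_lt_one (α := ℝ≥0∞))
  let A : ℕ × ℕ → Set Y := fun n => {x ∈ E | ∀ r : ℝ, 0 < r → r < 1 / ((n.2 : ℝ) + 1) →
    mixedH g (E ∩ closedBall x r) ≤ u n.1 * g (x, r)}
  have hA : ∀ n, mixedH g (A n) = 0 := fun n =>
    mixedH_eq_zero_of_le_mul (ne_top_of_le_ne_top hfin (mixedH_mono (sep_subset _ _)))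
      (sep_subset _ _) (hu n.1).1.ne' (hu n.1).2 Nat.one_div_pos_of_nat fun x hx => hx.2
  refine le_antisymm ((mixedH_mono (E := ⋃ n, A n) ?_).trans ?_) zero_le
  · rintro x ⟨hxE, hx⟩
    obtain ⟨m, hm⟩ := (hulim.eventually_const_lt hx).exists
    obtain ⟨ε, hε, hεr⟩ := (mem_nhdsGT_iff_exists_Ioo_subset).1
      (eventually_lt_of_limsup_lt hm)
    obtain ⟨n, hn⟩ := exists_nat_one_div_lt (mem_Ioi.1 hε)
    refine mem_iUnion.2 ⟨(m, n), hxE, fun r hr0 hr => ?_⟩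
    exact (ENNReal.div_le_iff (hg0 x hxE r hr0) (hgt x hxE r hr0)).1
      (mem_ofPred.1 (hεr ⟨hr0, hr.trans hn⟩)).le
  · exact ((measure_iUnion_null hA : mixedHOuter g (⋃ n, A n) = 0)).le

variable [MeasurableSpace Y] [BorelSpace Y]

/-- The multifractal Hausdorff measure as a Borel measure. -/
def mixedHMeasure (g : Y × ℝ → ℝ≥0∞) : Measure Y :=
  (mixedHOuter g).toMeasure
    ((BorelSpace.measurable_eq (α := Y)).trans_le (mixedHOuter_isMetric g).borel_le_caratheodory)

theorem mixedH_le_mixedHMeasure (g : Y × ℝ → ℝ≥0∞) (E : Set Y) :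
    mixedH g E ≤ mixedHMeasure g E :=
  le_toMeasure_apply (mixedHOuter g) _ E

theorem mixedHMeasure_apply (g : Y × ℝ → ℝ≥0∞) (hE : MeasurableSet E) :
    mixedHMeasure g E = mixedH g E :=
  toMeasure_apply (mixedHOuter g) _ hE

theorem mixedHMeasure_restrict_apply (g : Y × ℝ → ℝ≥0∞) (hE : MeasurableSet E)
    (hF : MeasurableSet F) : (mixedHMeasure g).restrict E F = mixedH g (E ∩ F) := by
  rw [Measure.restrict_apply hF, inter_comm, mixedHMeasure_apply g (hE.inter hF)]

theorem isFiniteMeasure_mixedHMeasure_restrict (hE : MeasurableSet E) (hfin : mixedH g E ≠ ⊤) :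
    IsFiniteMeasure ((mixedHMeasure g).restrict E) :=
  ⟨by rw [Measure.restrict_apply_univ, mixedHMeasure_apply g hE]; exact hfin.lt_top⟩

variable [SecondCountableTopology Y]

theorem measurable_measure_closedBall (σ : Measure Y) [SFinite σ] (r : ℝ) :
    Measurable fun x => σ (closedBall x r) := by
  have h : MeasurableSet {p : Y × Y | dist p.2 p.1 ≤ r} :=
    measurableSet_le (measurable_snd.dist measurable_fst) measurable_const
  exact measurable_measure_prodMk_left h

theorem measurableSet_frequently_mul_lt (hE : MeasurableSet E) (hfin : mixedH g E ≠ ⊤)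
    (hgm : ∀ r, Measurable fun x => g (x, r))
    (hgr : ∀ x ∈ E, ∀ r, 0 < r → Tendsto (fun s => g (x, s)) (𝓝[>] r) (𝓝 (g (x, r))))
    (hct : c ≠ ⊤) :
    MeasurableSet {x ∈ E |
      ∃ᶠ r in 𝓝[>] (0 : ℝ), c * g (x, r) < mixedH g (E ∩ closedBall x r)} := by
  have := isFiniteMeasure_mixedHMeasure_restrict hE hfin
  have hball : ∀ x r, mixedH g (E ∩ closedBall x r) =
      (mixedHMeasure g).restrict E (closedBall x r) := fun x r =>
    (mixedHMeasure_restrict_apply g hE measurableSet_closedBall).symm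
  have heq : {x ∈ E | ∃ᶠ r in 𝓝[>] (0 : ℝ), c * g (x, r) < mixedH g (E ∩ closedBall x r)} =
      E ∩ ⋂ n : ℕ, ⋃ s : ℚ, ⋃ (_ : (s : ℝ) ∈ Ioo (0 : ℝ) (1 / ((n : ℝ) + 1))),
        {x | c * g (x, s) < mixedH g (E ∩ closedBall x s)} := by
    ext x
    refine and_congr_right fun hxE => ⟨fun hx => mem_iInter.2 fun n => ?_, fun hx => ?_⟩
    · obtain ⟨r, hr, hr0, hrn⟩ :=
        (hx.and_eventually (Ioo_mem_nhdsGT Nat.one_div_pos_of_nat)).exists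
      have hlim : Tendsto (fun s => c * g (x, s)) (𝓝[>] r) (𝓝 (c * g (x, r))) :=
        ENNReal.Tendsto.const_mul (hgr x hxE r hr0) (Or.inr hct)
      obtain ⟨ε, hε, hsub⟩ := mem_nhdsGT_iff_exists_Ioo_subset.1 (hlim.eventually_lt_const hr)
      obtain ⟨s, hrs, hs⟩ := exists_rat_btwn (lt_min (mem_Ioi.1 hε) hrn)
      refine mem_iUnion₂.2 ⟨s, ⟨hr0.trans hrs, hs.trans_le (min_le_right _ _)⟩, ?_⟩
      exact (mem_ofPred.1 (hsub ⟨hrs, hs.trans_le (min_le_left _ _)⟩)).trans_le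
        (mixedH_mono (inter_subset_inter_right _ (closedBall_subset_closedBall hrs.le)))
    · refine (nhdsGT_basis (0 : ℝ)).frequently_iff.2 fun {ε} hε => ?_
      obtain ⟨n, hn⟩ := exists_nat_one_div_lt hε
      obtain ⟨s, hs, hxs⟩ := mem_iUnion₂.1 (mem_iInter.1 hx n)
      exact ⟨s, ⟨hs.1, hs.2.trans hn⟩, hxs⟩
  rw [heq]
  refine hE.inter (.iInter fun n => .iUnion fun s => .iUnion fun _ => ?_)
  simp only [hball]
  exact measurableSet_lt ((hgm s).const_mul c) (measurable_measure_closedBall _ _)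

variable [HasBesicovitchCovering Y]

theorem mul_preH_le_measure_of_isOpen {U : Set Y} (hE : MeasurableSet E) (hfin : mixedH g E ≠ ⊤)
    (hGE : G ⊆ E) (hδ : 0 < δ) (hU : IsOpen U) (hGU : G ⊆ U)
    (h : ∀ x ∈ G, ∃ᶠ r in 𝓝[>] (0 : ℝ), c * g (x, r) ≤ mixedH g (E ∩ closedBall x r)) :
    c * preH g δ G ≤ (mixedHMeasure g).restrict E U := by
  have := isFiniteMeasure_mixedHMeasure_restrict hE hfin
  set θ := (mixedHMeasure g).restrict E with hθ
  have hball : ∀ x r, mixedH g (E ∩ closedBall x r) = θ (closedBall x r) := fun x r =>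
    (mixedHMeasure_restrict_apply g hE measurableSet_closedBall).symm
  have hR : ∀ x, ∃ ρ : ℝ, x ∈ G → 0 < ρ ∧ closedBall x ρ ⊆ U := fun x => by
    by_cases hx : x ∈ G
    · obtain ⟨ρ, hρ, hsub⟩ := nhds_basis_closedBall.mem_iff.1 (hU.mem_nhds (hGU hx))
      exact ⟨ρ, fun _ => ⟨hρ, hsub⟩⟩
    · exact ⟨0, fun hx' => absurd hx' hx⟩
  choose ρ hρ using hR
  obtain ⟨t, r, htc, htG, htr, hnull, hdisj⟩ := Besicovitch.exists_disjoint_closedBall_covering_ae θ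
    (fun x => {r | c * g (x, r) ≤ θ (closedBall x r)}) G (fun x hx ε hε => by
      obtain ⟨r, hr, hrε⟩ := ((h x hx).and_eventually (Ioo_mem_nhdsGT hε)).exists
      exact ⟨r, hr.trans_eq (hball x r), hrε⟩)
    (fun x => min δ (ρ x)) (fun x hx => lt_min hδ (hρ x hx).1)
  set W := ⋃ x ∈ t, closedBall x (r x)
  have hrest : preH g δ (G \ W) = 0 := by
    refine le_antisymm ?_ zero_le
    calc preH g δ (G \ W) ≤ mixedH g (G \ W) :=
          (preH_le_barH hδ).trans (barH_le_mixedH Subset.rfl)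
      _ ≤ mixedHMeasure g (G \ W) := mixedH_le_mixedHMeasure g _
      _ = θ (G \ W) := (Measure.restrict_eq_self _ (sdiff_subset.trans hGE)).symm
      _ ≤ 0 := hnull.le
  have hcover : IsCenteredCover (G ∩ W) δ ((fun x => (x, r x)) '' t) := by
    refine ⟨htc.image _, ?_, fun x hx => ?_⟩
    · rintro _ ⟨x, hx, rfl⟩
      obtain ⟨-, hr0, hr1⟩ := htr x hx
      exact ⟨⟨htG hx, mem_iUnion₂.2 ⟨x, hx, mem_closedBall_self hr0.le⟩⟩, hr0,
        hr1.trans_le (min_le_left _ _)⟩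
    · obtain ⟨y, hy, hxy⟩ := mem_iUnion₂.1 hx.2
      exact mem_iUnion₂.2 ⟨_, mem_image_of_mem _ hy, hxy⟩
  calc c * preH g δ G ≤ c * (preH g δ (G ∩ W) + preH g δ (G \ W)) := by
        gcongr
        exact (congrArg _ (inter_union_sdiff G W)).symm.trans_le (preH_union_le g δ _ _)
    _ = c * preH g δ (G ∩ W) := by rw [hrest, add_zero]
    _ ≤ c * ∑' x : t, g (x, r x) := by
        gcongr
        refine (preH_le_tsum hcover).trans_eq ?_
        exact tsum_image g fun x _ y _ hxy => congrArg Prod.fst hxy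
    _ = ∑' x : t, c * g (x, r x) := ENNReal.tsum_mul_left.symm
    _ ≤ ∑' x : t, θ (closedBall x (r x)) := ENNReal.tsum_le_tsum fun x => (htr x x.2).1
    _ = θ W := (measure_biUnion htc hdisj fun _ _ => measurableSet_closedBall).symm
    _ ≤ θ U := measure_mono <| iUnion₂_subset fun x hx =>
        (closedBall_subset_closedBall ((htr x hx).2.2.le.trans (min_le_right _ _))).trans
          (hρ x (htG hx)).2

/-- A measurable set on which the density of `H` exceeds `c > 1` at arbitrarily small scales is
null. -/
theorem mixedH_eq_zero_of_frequently_mul_le (hE : MeasurableSet E) (hfin : mixedH g E ≠ ⊤)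
    (hF : MeasurableSet F) (hFE : F ⊆ E) (hc : 1 < c) (hct : c ≠ ⊤)
    (h : ∀ x ∈ F, ∃ᶠ r in 𝓝[>] (0 : ℝ), c * g (x, r) ≤ mixedH g (E ∩ closedBall x r)) :
    mixedH g F = 0 := by
  have := isFiniteMeasure_mixedHMeasure_restrict hE hfin
  have hc0 : c ≠ 0 := (one_pos.trans hc).ne'
  have hU : ∀ U, IsOpen U → F ⊆ U → c * mixedH g F ≤ (mixedHMeasure g).restrict E U := by
    intro U hU hFU
    rw [mul_comm, ← ENNReal.le_div_iff_mul_le (Or.inl hc0) (Or.inl hct)]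
    refine iSup₂_le fun G hG => iSup₂_le fun δ hδ => ?_
    rw [ENNReal.le_div_iff_mul_le (Or.inl hc0) (Or.inl hct), mul_comm]
    exact mul_preH_le_measure_of_isOpen hE hfin (hG.trans hFE) hδ hU (hG.trans hFU)
      fun x hx => h x (hG hx)
  have hle : c * mixedH g F ≤ mixedH g F := by
    calc c * mixedH g F ≤ (mixedHMeasure g).restrict E F := by
          rw [F.measure_eq_iInf_isOpen]
          exact le_iInf₂ fun U hFU => le_iInf fun hUo => hU U hUo hFU
      _ = mixedH g F := by
          rw [mixedHMeasure_restrict_apply g hE hF, inter_eq_right.2 hFE]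
  by_contra h0
  have hFt : mixedH g F ≠ ⊤ := ne_top_of_le_ne_top hfin (mixedH_mono hFE)
  exact absurd hle (not_le.2 (by simpa using ENNReal.mul_lt_mul_left h0 hFt hc))

theorem mixedH_sep_one_lt_limsup (hE : MeasurableSet E) (hfin : mixedH g E ≠ ⊤)
    (hgm : ∀ r, Measurable fun x => g (x, r))
    (hgr : ∀ x ∈ E, ∀ r, 0 < r → Tendsto (fun s => g (x, s)) (𝓝[>] r) (𝓝 (g (x, r)))) :
    mixedH g {x ∈ E |
      1 < limsup (fun r : ℝ => mixedH g (E ∩ closedBall x r) / g (x, r)) (𝓝[>] (0 : ℝ))} = 0 := by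
  obtain ⟨u, -, hu, hulim⟩ := exists_seq_strictAnti_tendsto' ENNReal.one_lt_top
  let A : ℕ → Set Y := fun n => {x ∈ E |
    ∃ᶠ r in 𝓝[>] (0 : ℝ), u n * g (x, r) < mixedH g (E ∩ closedBall x r)}
  have hA : ∀ n, mixedH g (A n) = 0 := fun n =>
    mixedH_eq_zero_of_frequently_mul_le hE hfin
      (measurableSet_frequently_mul_lt hE hfin hgm hgr (hu n).2.ne) (sep_subset _ _)
      (hu n).1 (hu n).2.ne fun x hx => hx.2.mono fun _ => le_of_lt
  refine le_antisymm ((mixedH_mono (E := ⋃ n, A n) ?_).trans ?_) zero_le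
  · rintro x ⟨hxE, hx⟩
    obtain ⟨n, hn⟩ := (hulim.eventually_lt_const hx).exists
    refine mem_iUnion.2 ⟨n, hxE, ?_⟩
    exact (frequently_lt_of_lt_limsup (by isBoundedDefault) hn).mono
      fun r hr => ENNReal.mul_lt_of_lt_div hr
  · exact ((measure_iUnion_null hA : mixedHOuter g (⋃ n, A n) = 0)).le

end CenteredHausdorff

section Gauge

variable {Y : Type*} [MetricSpace Y] [MeasurableSpace Y] {k : ℕ} {μ : Fin k → Measure Y}
  {ν : Measure Y} {x : Y} {r : ℝ}

theorem tendsto_measure_closedBall_nhdsGT [OpensMeasurableSpace Y] (σ : Measure Y)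
    [IsFiniteMeasure σ] (x : Y) (r : ℝ) :
    Tendsto (fun s => σ (closedBall x s)) (𝓝[>] r) (𝓝 (σ (closedBall x r))) := by
  have h := tendsto_measure_biInter_gt (μ := σ) (s := fun s => closedBall x s) (a := r)
    (fun _ _ => measurableSet_closedBall.nullMeasurableSet)
    (fun _ _ _ hij => closedBall_subset_closedBall hij) ⟨r + 1, by simp, measure_ne_top _ _⟩
  have hI : ⋂ s > r, closedBall x s = closedBall x r := by
    ext y
    simpa only [mem_iInter, mem_closedBall] using forall_gt_imp_ge_iff_le_of_dense
  rwa [hI] at h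

theorem rpow_measure_closedBall_ne_zero_ne_top {σ : Measure Y} [IsFiniteMeasure σ]
    (hx : x ∈ msupport σ) (hr : 0 < r) (s : ℝ) :
    σ (closedBall x r) ^ s ≠ 0 ∧ σ (closedBall x r) ^ s ≠ ⊤ :=
  ⟨(ENNReal.rpow_pos (hx r hr) (measure_ne_top _ _)).ne',
    ENNReal.rpow_ne_top_of_ne_zero (hx r hr).ne' (measure_ne_top _ _)⟩

variable [∀ j, IsFiniteMeasure (μ j)] [IsFiniteMeasure ν]

theorem mgauge_ne_zero (q : Fin k → ℝ) (t : ℝ) (hx : x ∈ Smu μ ∩ msupport ν) (hr : 0 < r) :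
    mgauge μ q ν t (x, r) ≠ 0 :=
  mul_ne_zero (Finset.prod_ne_zero_iff.2 fun j _ =>
    (rpow_measure_closedBall_ne_zero_ne_top (mem_iInter.1 hx.1 j) hr _).1)
    (rpow_measure_closedBall_ne_zero_ne_top hx.2 hr _).1

theorem mgauge_ne_top (q : Fin k → ℝ) (t : ℝ) (hx : x ∈ Smu μ ∩ msupport ν) (hr : 0 < r) :
    mgauge μ q ν t (x, r) ≠ ⊤ :=
  ENNReal.mul_ne_top (ENNReal.prod_ne_top fun j _ =>
    (rpow_measure_closedBall_ne_zero_ne_top (mem_iInter.1 hx.1 j) hr _).2)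
    (rpow_measure_closedBall_ne_zero_ne_top hx.2 hr _).2

theorem tendsto_mgauge_nhdsGT [OpensMeasurableSpace Y] (q : Fin k → ℝ) (t : ℝ)
    (hx : x ∈ Smu μ ∩ msupport ν) (hr : 0 < r) :
    Tendsto (fun s => mgauge μ q ν t (x, s)) (𝓝[>] r) (𝓝 (mgauge μ q ν t (x, r))) := by
  have hμ := fun j =>
    rpow_measure_closedBall_ne_zero_ne_top (σ := μ j) (mem_iInter.1 hx.1 j) hr (q j)
  refine ENNReal.Tendsto.mul (ENNReal.tendsto_finsetProd_of_ne_top _ (fun j _ =>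
      ((ENNReal.continuous_rpow_const.tendsto _).comp
        (tendsto_measure_closedBall_nhdsGT (μ j) x r))) fun j _ => (hμ j).2)
    (Or.inl (Finset.prod_ne_zero_iff.2 fun j _ => (hμ j).1))
    ((ENNReal.continuous_rpow_const.tendsto _).comp (tendsto_measure_closedBall_nhdsGT ν x r))
    (Or.inr (ENNReal.prod_ne_top fun j _ => (hμ j).2))

theorem measurable_mgauge [BorelSpace Y] [SecondCountableTopology Y] (q : Fin k → ℝ) (t r : ℝ) :
    Measurable fun x => mgauge μ q ν t (x, r) :=
  (Finset.measurable_fun_prod _ fun j _ => (measurable_measure_closedBall (μ j) r).pow_const _).mul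
    ((measurable_measure_closedBall ν r).pow_const _)

end Gauge

/-- with doubling measures and `H^{q,t}_{μ,ν}(E) < ∞`, the upper density
`D̄^{q,t}_{μ,ν}(x,E)` equals `1` for `H^{q,t}_{μ,ν}`-almost every `x ∈ E`. -/
theorem upperSetDensity_ae_one
    (d k : ℕ) (hd : 1 ≤ d) (hk : 1 ≤ k)
    (μ : Fin k → Measure (Rd d)) (ν : Measure (Rd d))
    (hμ : ∀ j, IsProbabilityMeasure (μ j)) (hν : IsProbabilityMeasure ν)
    (hμD : ∀ j, IsDoubling (μ j)) (hνD : IsDoubling ν)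
    (q : Fin k → ℝ) (t : ℝ)
    (E : Set (Rd d)) (hE : MeasurableSet E) (hES : E ⊆ Smu μ ∩ msupport ν)
    (hfin : mixedH (mgauge μ q ν t) E < ⊤) :
    mixedH (mgauge μ q ν t) {x ∈ E | DUpper μ q ν t E x ≠ 1} = 0 := by
  have hlt := mixedH_sep_limsup_lt_one hfin.ne
    (fun x hx r hr => mgauge_ne_zero q t (hES hx) hr)
    (fun x hx r hr => mgauge_ne_top q t (hES hx) hr)
  have hgt := mixedH_sep_one_lt_limsup hE hfin.ne (measurable_mgauge q t)
    (fun x hx r hr => tendsto_mgauge_nhdsGT q t (hES hx) hr)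
  refine measure_mono_null (μ := mixedHOuter (mgauge μ q ν t)) ?_ (measure_union_null hlt hgt)
  rintro x ⟨hxE, hx⟩
  exact (lt_or_gt_of_ne hx).imp (And.intro hxE) (And.intro hxE)

end MixedMultifractal
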